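/- Competitive ratio of STORM (Theorem 2, core inequality): Let U be a finite type and f : Finset U → ℝ be nonnegative, monotone and submodular. Let T ≤ T' be positive integers, A^1, …, A^{T'} ⊆ U, and π : {1, …, T} → {1, …, T'} injective with f(A^{π(T)} | ⋃_{t=1}^{T−1} A^{π(t)}) ≥ f(A^s | ⋃_{t=1}^{T−1} A^{π(t)}) for every s ∉ {π(1), …, π(T−1)}. If moreover O ⊆ U is a set with f(⋃_{t=1}^{T'} A^t) ≥ (1/4) · f(O), then f(⋃_{t=1}^{T} A^{π(t)}) ≥ (1/(4(T'−T+1))) · f(O). -/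

import Mathlib

/-- A set function is submodular if
`f (A ∪ {e}) - f A ≥ f (B ∪ {e}) - f B` for all `A ⊆ B` and `e ∉ B`. -/
def IsSubmodular {U : Type*} [DecidableEq U] (f : Finset U → ℝ) : Prop :=
  ∀ A B : Finset U, A ⊆ B → ∀ e ∉ B, f (insert e A) - f A ≥ f (insert e B) - f B

/-- A set function is monotone if `f A ≤ f B` whenever `A ⊆ B`. -/
def IsMonotoneFn {U : Type*} [DecidableEq U] (f : Finset U → ℝ) : Prop :=
  ∀ A B : Finset U, A ⊆ B → f A ≤ f B

/-- The marginal gain `f(A | B) = f (A ∪ B) - f B`. -/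
def marg {U : Type*} [DecidableEq U] (f : Finset U → ℝ) (A B : Finset U) : ℝ :=
  f (A ∪ B) - f B

theorem marg_anti {U : Type*} [DecidableEq U] {f : Finset U → ℝ}
    (hmono : IsMonotoneFn f) (hsub : IsSubmodular f) {A B : Finset U} (hAB : A ⊆ B)
    (C : Finset U) : marg f C B ≤ marg f C A := by
  unfold marg
  induction C using Finset.induction_on with
  | empty => simp
  | insert e C _ ih =>
    rw [Finset.insert_union, Finset.insert_union]
    by_cases he : e ∈ C ∪ B
    · rw [Finset.insert_eq_of_mem he]
      have := hmono (C ∪ A) (insert e (C ∪ A)) (Finset.subset_insert _ _)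
      linarith
    · have := hsub (C ∪ A) (C ∪ B) (Finset.union_subset_union_right hAB) e he
      linarith

theorem marg_biUnion_le_sum {U ι : Type*} [DecidableEq U] {f : Finset U → ℝ}
    (hmono : IsMonotoneFn f) (hsub : IsSubmodular f) (A : ι → Finset U) (W : Finset U)
    (S : Finset ι) : marg f (S.biUnion A) W ≤ ∑ s ∈ S, marg f (A s) W := by
  classical
  induction S using Finset.induction_on with
  | empty => simp [marg]
  | insert s S hs ih =>
    rw [Finset.sum_insert hs, Finset.biUnion_insert]
    have := marg_anti hmono hsub (Finset.subset_union_right : W ⊆ S.biUnion A ∪ W) (A s)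
    simp only [marg, Finset.union_assoc] at *
    linarith

/-- Competitive ratio of STORM (Theorem 2, core inequality).
Under the greedy-last-selection hypothesis, if moreover
`f (⋃_{t=1}^{T'} A^t) ≥ (1/4) * f O`, then
`f (⋃_{t=1}^{T} A^{π(t)}) ≥ (1/(4(T'-T+1))) * f O`. -/
theorem storm_competitive_ratio {U : Type*} [Fintype U] [DecidableEq U]
    (f : Finset U → ℝ) (hnonneg : ∀ A : Finset U, 0 ≤ f A)
    (hmono : IsMonotoneFn f) (hsub : IsSubmodular f)
    (T T' : ℕ) (hT : 0 < T) (hTT' : T ≤ T')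
    (A : Fin T' → Finset U) (π : Fin T → Fin T') (hπ : Function.Injective π)
    (hgreedy : ∀ s : Fin T', (∀ t : Fin T, (t : ℕ) < T - 1 → π t ≠ s) →
      marg f (A (π ⟨T - 1, by omega⟩))
          ((Finset.univ.filter (fun t : Fin T => (t : ℕ) < T - 1)).biUnion
            (fun t => A (π t)))
        ≥ marg f (A s)
          ((Finset.univ.filter (fun t : Fin T => (t : ℕ) < T - 1)).biUnion
            (fun t => A (π t))))
    (O : Finset U) (hO : f (Finset.univ.biUnion A) ≥ (1 / 4 : ℝ) * f O) :
    f (Finset.univ.biUnion (fun t : Fin T => A (π t)))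
      ≥ (1 / (4 * ((T' : ℝ) - T + 1))) * f O := by
  set P := Finset.univ.filter (fun t : Fin T => (t : ℕ) < T - 1) with hP
  set W := P.biUnion (fun t => A (π t)) with hW
  set G := Finset.univ.biUnion (fun t : Fin T => A (π t)) with hG
  have hPcard : P.card = T - 1 := by
    rw [hP, Fin.card_filter_val_lt]
    omega
  have hScard : (((P.image π)ᶜ.card : ℕ) : ℝ) = (T' : ℝ) - T + 1 := by
    rw [Finset.card_compl, Finset.card_image_of_injective _ hπ, hPcard, Fintype.card_fin,
      Nat.cast_sub (by omega), Nat.cast_sub (by omega)]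
    push_cast
    ring
  have hlast : marg f (A (π ⟨T - 1, by omega⟩)) W ≤ f G - f W := by
    refine sub_le_sub_right (hmono _ _ (Finset.union_subset ?_ ?_)) _
    · exact Finset.subset_biUnion_of_mem (fun t : Fin T => A (π t)) (Finset.mem_univ _)
    · exact Finset.biUnion_subset_biUnion_of_subset_left _ (Finset.subset_univ _)
  have hsum : ∑ s ∈ (P.image π)ᶜ, marg f (A s) W ≤ ((T' : ℝ) - T + 1) * (f G - f W) := by
    rw [← hScard, ← nsmul_eq_mul]
    refine Finset.sum_le_card_nsmul _ _ _ fun s hs => le_trans (hgreedy s ?_) hlast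
    rintro t ht rfl
    exact Finset.mem_compl.mp hs (Finset.mem_image_of_mem π (by simpa [hP] using ht))
  have hcover : Finset.univ.biUnion A ⊆ (P.image π)ᶜ.biUnion A ∪ W := by
    refine Finset.biUnion_subset.mpr fun s _ => ?_
    by_cases hs : s ∈ P.image π
    · obtain ⟨t, ht, rfl⟩ := Finset.mem_image.mp hs
      exact (Finset.subset_biUnion_of_mem (fun t => A (π t)) ht).trans Finset.subset_union_right
    · exact (Finset.subset_biUnion_of_mem A (Finset.mem_compl.mpr hs)).trans
        Finset.subset_union_left
  have hall := hmono _ _ hcover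
  have hgain := marg_biUnion_le_sum hmono hsub A W (P.image π)ᶜ
  unfold marg at hgain hsum
  have hk : (1 : ℝ) ≤ (T' : ℝ) - T + 1 := by
    have : (T : ℝ) ≤ T' := by exact_mod_cast hTT'
    linarith
  have hkW := mul_nonneg (sub_nonneg.mpr hk) (hnonneg W)
  rw [ge_iff_le, one_div_mul_eq_div, div_le_iff₀ (by linarith)]
  linarith
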